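/- Let f : ℝ → ℝ³ be a C^∞ embedding of period L parametrized by arc length with curvature κ(s) = |f''(s)| > 0 for all s, let P ∉ f([0,L]), r > 0, and set f̃ = I_{P,r}∘f. If f̃ also has nowhere vanishing curvature (f̃'(s) × f̃''(s) ≠ 0 for all s), then Wr(f̃) = −Wr(f). -/

import Mathlib

noncomputable section
open Real

/-- Euclidean 3-space. -/
abbrev E3 : Type := EuclideanSpace ℝ (Fin 3)

/-- The dot product of two vectors in `E3`. -/
def dot3 (u v : E3) : ℝ := u 0 * v 0 + u 1 * v 1 + u 2 * v 2

/-- The cross product of two vectors in `E3`. -/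
def cross3 (u v : E3) : E3 :=
  (WithLp.equiv 2 (Fin 3 → ℝ)).symm
    ![u 1 * v 2 - u 2 * v 1, u 2 * v 0 - u 0 * v 2, u 0 * v 1 - u 1 * v 0]

/-- The determinant `det(u, v, w)` of three vectors in `E3`. -/
def det3 (u v w : E3) : ℝ := dot3 u (cross3 v w)

/-- The writhe of a closed curve `g` of period `L`, given by the Gauss integral. -/
def writhe (g : ℝ → E3) (L : ℝ) : ℝ :=
  (1 / (4 * π)) * ∫ s in (0:ℝ)..L, ∫ t in (0:ℝ)..L,
    det3 (deriv g s) (deriv g t) (g s - g t) / ‖g s - g t‖ ^ 3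

/-- The inversion in the sphere of center `P` and radius `r`. -/
def inv3 (P : E3) (r : ℝ) (x : E3) : E3 := P + (r ^ 2 / ‖x - P‖ ^ 2) • (x - P)

/-- The differential of the inversion `inv3 P r` at `x`, applied to `v`. -/
def dInv (P : E3) (r : ℝ) (x v : E3) : E3 :=
  (r ^ 2 / ‖x - P‖ ^ 2) • (v - ((2 * dot3 (x - P) v) / ‖x - P‖ ^ 2) • (x - P))

/-- The total twist of a closed curve `g` of period `L` with unit normal framing `w`. -/
def twist (g w : ℝ → E3) (L : ℝ) : ℝ :=
  (1 / (2 * π)) * ∫ s in (0:ℝ)..L,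
    dot3 (deriv w s) (cross3 ((‖deriv g s‖)⁻¹ • deriv g s) (w s))

/-- The principal normal `e₂ = f''/κ` of an arc-length parametrized curve. -/
def e2 (f : ℝ → E3) (s : ℝ) : E3 := (‖deriv (deriv f) s‖)⁻¹ • deriv (deriv f) s

/-- The binormal `e₃ = e₁ × e₂` of an arc-length parametrized curve. -/
def e3 (f : ℝ → E3) (s : ℝ) : E3 := cross3 (deriv f s) (e2 f s)

/-- The torsion `τ = e₂'·e₃` of an arc-length parametrized curve. -/
def torsionArc (f : ℝ → E3) (s : ℝ) : ℝ := dot3 (deriv (e2 f) s) (e3 f s)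

/-- The total torsion `Tω = (1/2π) ∫ τ` of an arc-length parametrized closed curve. -/
def totalTorsionArc (f : ℝ → E3) (L : ℝ) : ℝ :=
  (1 / (2 * π)) * ∫ s in (0:ℝ)..L, torsionArc f s

/-- The torsion `τ_g = det(g', g'', g''')/|g' × g''|²` of a regular curve. -/
def torsionGen (g : ℝ → E3) (s : ℝ) : ℝ :=
  det3 (deriv g s) (deriv (deriv g) s) (deriv (deriv (deriv g)) s) /
    ‖cross3 (deriv g s) (deriv (deriv g) s)‖ ^ 2

/-- The total torsion `Tω = (1/2π) ∫ τ_g |g'|` of a regular closed curve. -/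
def totalTorsionGen (g : ℝ → E3) (L : ℝ) : ℝ :=
  (1 / (2 * π)) * ∫ s in (0:ℝ)..L, torsionGen g s * ‖deriv g s‖

/-- The osculating circle at `s` of an arc-length parametrized curve with `κ(s) > 0`:
the circle of center `f(s) + (1/κ(s)) e₂(s)` and radius `1/κ(s)` in the plane through
`f(s)` spanned by `e₁(s)` and `e₂(s)`. -/
def osculatingCircleArc (f : ℝ → E3) (s : ℝ) : Set E3 :=
  {y | (∃ a b : ℝ, y = f s + a • deriv f s + b • e2 f s) ∧
    ‖y - (f s + (‖deriv (deriv f) s‖)⁻¹ • e2 f s)‖ = (‖deriv (deriv f) s‖)⁻¹}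

/-- The curvature tube of `f`: the union of all osculating circles. -/
def curvatureTube (f : ℝ → E3) : Set E3 := ⋃ s : ℝ, osculatingCircleArc f s


/-! ### Algebra of `dot3` and `det3` -/

lemma norm_sq_eq_dot3 (v : E3) : ‖v‖ ^ 2 = dot3 v v := by
  rw [EuclideanSpace.norm_sq_eq, Fin.sum_univ_three]
  simp [dot3, sq]

lemma det3_apply (u v w : E3) : det3 u v w =
    u 0 * (v 1 * w 2 - v 2 * w 1) + u 1 * (v 2 * w 0 - v 0 * w 2)
      + u 2 * (v 0 * w 1 - v 1 * w 0) := by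
  simp [det3, dot3, cross3]

lemma abs_apply_le_norm (v : E3) (i : Fin 3) : |v i| ≤ ‖v‖ := by
  simpa using PiLp.norm_apply_le v i

lemma abs_dot3_le (u v : E3) : |dot3 u v| ≤ 3 * (‖u‖ * ‖v‖) := by
  have h (i : Fin 3) : |u i * v i| ≤ ‖u‖ * ‖v‖ := by
    rw [abs_mul]
    exact mul_le_mul (abs_apply_le_norm u i) (abs_apply_le_norm v i) (abs_nonneg _) (norm_nonneg _)
  unfold dot3
  have h1 := abs_add_three (u 0 * v 0) (u 1 * v 1) (u 2 * v 2)
  linarith [h 0, h 1, h 2]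

lemma abs_det3_le (u v w : E3) : |det3 u v w| ≤ 6 * (‖u‖ * ‖v‖ * ‖w‖) := by
  have h (i j k : Fin 3) : |u i * (v j * w k)| ≤ ‖u‖ * ‖v‖ * ‖w‖ := by
    rw [abs_mul, abs_mul, mul_assoc]
    gcongr <;> exact abs_apply_le_norm _ _
  have e (i j k : Fin 3) : |u i * (v j * w k - v k * w j)| ≤ 2 * (‖u‖ * ‖v‖ * ‖w‖) := by
    rw [mul_sub]
    linarith [abs_sub (u i * (v j * w k)) (u i * (v k * w j)), h i j k, h i k j]
  rw [det3_apply]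
  linarith [abs_add_three (u 0 * (v 1 * w 2 - v 2 * w 1)) (u 1 * (v 2 * w 0 - v 0 * w 2))
    (u 2 * (v 0 * w 1 - v 1 * w 0)), e 0 1 2, e 1 2 0, e 2 0 1]

lemma norm_inversion_sub_inversion (x y : E3) (hx : x ≠ 0) (hy : y ≠ 0) (r : ℝ) :
    ‖(r ^ 2 / ‖x‖ ^ 2) • x - (r ^ 2 / ‖y‖ ^ 2) • y‖ = r ^ 2 * ‖x - y‖ / (‖x‖ * ‖y‖) := by
  have ha : ‖x‖ ≠ 0 := norm_ne_zero_iff.2 hx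
  have hb : ‖y‖ ≠ 0 := norm_ne_zero_iff.2 hy
  refine (sq_eq_sq₀ (norm_nonneg _) (by positivity)).1 ?_
  have h1 := norm_sq_eq_dot3 x
  have h2 := norm_sq_eq_dot3 y
  have h3 := norm_sq_eq_dot3 (x - y)
  have h4 : dot3 (x - y) (x - y) = ‖x‖ ^ 2 + ‖y‖ ^ 2 - 2 * dot3 x y := by
    rw [h1, h2]; simp [dot3]; ring
  have h5 : ∀ α β : ℝ, dot3 (α • x - β • y) (α • x - β • y) =
      α ^ 2 * ‖x‖ ^ 2 + β ^ 2 * ‖y‖ ^ 2 - 2 * α * β * dot3 x y := by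
    intro α β
    rw [h1, h2]; simp [dot3]; ring
  have h6 : (r ^ 2 * ‖x - y‖ / (‖x‖ * ‖y‖)) ^ 2 = r ^ 4 * ‖x - y‖ ^ 2 / (‖x‖ * ‖y‖) ^ 2 := by ring
  rw [norm_sq_eq_dot3, h5, h6, h3, h4]
  field_simp
  ring

/-- The integrand of the Gauss integral in terms of the positions and velocities of two points. -/
def gaussDensity (x p y q : E3) : ℝ := det3 p q (x - y) / ‖x - y‖ ^ 3

/-- The coefficient of `dx` in a primitive of the sum of the Gauss form and its pullback under
inversion. -/
def primCoeff (x p y : E3) : ℝ := det3 p x y / (‖x‖ * ‖x - y‖ * (‖x‖ + ‖y‖ + ‖x - y‖))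

/-- The derivative of `primCoeff x p y` when `y` moves with velocity `q`. -/
def primCoeffDeriv (x p y q : E3) : ℝ :=
  det3 p x q / (‖x‖ * ‖x - y‖ * (‖x‖ + ‖y‖ + ‖x - y‖)) -
    det3 p x y * (dot3 (y - x) q / ‖x - y‖ * (‖x‖ + ‖y‖ + ‖x - y‖) +
      ‖x - y‖ * (dot3 y q / ‖y‖ + dot3 (y - x) q / ‖x - y‖)) /
      (‖x‖ * ‖x - y‖ ^ 2 * (‖x‖ + ‖y‖ + ‖x - y‖) ^ 2)

lemma gauss_scalar_identity (a b d S T₁ T₂ T₃ T₄ xp xq yp yq c : ℝ) (ha : a ≠ 0) (hb : b ≠ 0)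
    (hd : d ≠ 0) (hS : S ≠ 0) (hSd : S = a + b + d) (hc : 2 * c = a ^ 2 + b ^ 2 - d ^ 2)
    (hx : xp * T₁ - xq * T₂ + a ^ 2 * T₃ - c * T₄ = 0)
    (hy : yp * T₁ - yq * T₂ + c * T₃ - b ^ 2 * T₄ = 0) :
    (b ^ 2 * T₄ - a ^ 2 * T₃ - 2 * xp * T₁ + 2 * yq * T₂) / (a * b * d ^ 3) =
    -2 * ((-T₄ / (a * d * S) - T₂ * ((yq - xq) / d * S + d * (yq / b + (yq - xq) / d)) /
      (a * d ^ 2 * S ^ 2)) +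
      (T₃ / (b * d * S) + T₁ * ((xp - yp) / d * S + d * (xp / a + (xp - yp) / d)) /
      (b * d ^ 2 * S ^ 2))) - (T₄ - T₃) / d ^ 3 := by
  obtain rfl : c = (a ^ 2 + b ^ 2 - d ^ 2) / 2 := by linarith
  rw [← sub_eq_zero]
  have key : (b ^ 2 * T₄ - a ^ 2 * T₃ - 2 * xp * T₁ + 2 * yq * T₂) / (a * b * d ^ 3) -
    (-2 * ((-T₄ / (a * d * S) - T₂ * ((yq - xq) / d * S + d * (yq / b + (yq - xq) / d)) /
      (a * d ^ 2 * S ^ 2)) +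
      (T₃ / (b * d * S) + T₁ * ((xp - yp) / d * S + d * (xp / a + (xp - yp) / d)) /
      (b * d ^ 2 * S ^ 2))) - (T₄ - T₃) / d ^ 3) =
      -2 * (S + d) / (a * d ^ 3 * S ^ 2) *
        (xp * T₁ - xq * T₂ + a ^ 2 * T₃ - (a ^ 2 + b ^ 2 - d ^ 2) / 2 * T₄) +
      -2 * (S + d) / (b * d ^ 3 * S ^ 2) *
        (yp * T₁ - yq * T₂ + (a ^ 2 + b ^ 2 - d ^ 2) / 2 * T₃ - b ^ 2 * T₄) := by
    field_simp
    subst hSd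
    ring
  rw [key, hx, hy]
  ring

/-- The Gauss density after inversion, up to sign and an exact term. -/
lemma gaussDensity_inversion (x p y q : E3) (hx : x ≠ 0) (hy : y ≠ 0) {r : ℝ} (hr : 0 < r) :
    gaussDensity ((r ^ 2 / ‖x‖ ^ 2) • x) (dInv 0 r x p) ((r ^ 2 / ‖y‖ ^ 2) • y) (dInv 0 r y q) =
      -2 * (primCoeffDeriv x p y q + primCoeffDeriv y q x p) - gaussDensity x p y q := by
  have ha : ‖x‖ ≠ 0 := norm_ne_zero_iff.2 hx
  have hb : ‖y‖ ≠ 0 := norm_ne_zero_iff.2 hy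
  unfold gaussDensity primCoeffDeriv
  rw [norm_inversion_sub_inversion x y hx hy, norm_sub_rev y x]
  by_cases hd : ‖x - y‖ = 0
  · simp [hd]
  have hS : ‖x‖ + ‖y‖ + ‖x - y‖ ≠ 0 := by positivity
  have h1 := norm_sq_eq_dot3 x
  have h2 := norm_sq_eq_dot3 y
  have h3 := norm_sq_eq_dot3 (x - y)
  have h4 : 2 * dot3 x y = ‖x‖ ^ 2 + ‖y‖ ^ 2 - ‖x - y‖ ^ 2 := by
    rw [h1, h2, h3]; simp [dot3]; ring
  have key := gauss_scalar_identity ‖x‖ ‖y‖ ‖x - y‖ (‖x‖ + ‖y‖ + ‖x - y‖)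
    (det3 q x y) (det3 p x y) (det3 p q y) (det3 p q x) (dot3 x p) (dot3 x q) (dot3 y p)
    (dot3 y q) (dot3 x y) ha hb hd hS rfl h4
    (by rw [h1]; simp only [det3_apply, dot3]; ring)
    (by rw [h2]; simp only [det3_apply, dot3]; ring)
  have hdet1 : det3 p q (x - y) = det3 p q x - det3 p q y := by
    simp only [det3_apply, PiLp.sub_apply]; ring
  have hdet2 : det3 p x q = - det3 p q x := by simp only [det3_apply]; ring
  have hdet3 : det3 q y p = det3 p q y := by simp only [det3_apply]; ring
  have hdet4 : det3 q y x = - det3 q x y := by simp only [det3_apply]; ring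
  have hdet5 : dot3 (y - x) q = dot3 y q - dot3 x q := by simp only [dot3, PiLp.sub_apply]; ring
  have hdet6 : dot3 (x - y) p = dot3 x p - dot3 y p := by simp only [dot3, PiLp.sub_apply]; ring
  have hdet7 : ∀ α β m n : ℝ, det3 (α • (p - m • x)) (β • (q - n • y)) (α • x - β • y) =
      α * β * (α * det3 p q x - β * det3 p q y - m * β * det3 q x y + n * α * det3 p x y) := by
    intro α β m n
    simp only [det3_apply, PiLp.sub_apply, PiLp.smul_apply, smul_eq_mul]; ring
  simp only [dInv, sub_zero]
  rw [hdet7, hdet1, hdet2, hdet3, hdet4, hdet5, hdet6, add_comm ‖y‖ ‖x‖]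
  trans (‖y‖ ^ 2 * det3 p q x - ‖x‖ ^ 2 * det3 p q y - 2 * dot3 x p * det3 q x y +
    2 * dot3 y q * det3 p x y) / (‖x‖ * ‖y‖ * ‖x - y‖ ^ 3)
  · field_simp
  · rw [key]; ring

/-! ### Estimates for a closed unit speed curve -/

section Estimates

variable {g : ℝ → E3} {L : ℝ}

lemma exists_sub_eq_of_periodic (hL : 0 < L) (hper : Function.Periodic g L)
    (hinj : Set.InjOn g (Set.Ico 0 L)) {s t : ℝ} (h : g s = g t) : ∃ n : ℤ, t = s + n * L := by
  have e (u : ℝ) : g (toIcoMod hL 0 u) = g u := by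
    rw [toIcoMod]
    exact hper.sub_zsmul_eq _
  have m (u : ℝ) : toIcoMod hL 0 u ∈ Set.Ico 0 L := by
    simpa using toIcoMod_mem_Ico hL 0 u
  have h1 := hinj (m s) (m t) (by rw [e, e, h])
  simp only [toIcoMod, zsmul_eq_mul] at h1
  refine ⟨toIcoDiv hL 0 t - toIcoDiv hL 0 s, ?_⟩
  push_cast
  linarith

lemma exists_abs_sub_le_half (hL : 0 < L) (s t : ℝ) : ∃ n : ℤ, |t + n * L - s| ≤ L / 2 := by
  refine ⟨-round ((t - s) / L), ?_⟩
  have h := abs_sub_round ((t - s) / L)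
  have e : t + ((-round ((t - s) / L) : ℤ) : ℝ) * L - s =
      ((t - s) / L - round ((t - s) / L)) * L := by
    push_cast
    field_simp
    ring
  rw [e, abs_mul, abs_of_pos hL]
  nlinarith

lemma norm_sub_le_of_norm_deriv_deriv_le {M : ℝ} (hg : ContDiff ℝ 2 g)
    (hM : ∀ s, ‖deriv (deriv g) s‖ ≤ M) (s t : ℝ) : ‖deriv g t - deriv g s‖ ≤ M * |t - s| := by
  have h1 : ContDiff ℝ 1 (deriv g) := (contDiff_succ_iff_deriv (n := 1)).1 hg |>.2.2
  simpa using convex_univ.norm_image_sub_le_of_norm_deriv_le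
    (fun x _ => (h1.differentiable (by norm_num)).differentiableAt) (fun x _ => hM x)
    (Set.mem_univ s) (Set.mem_univ t)

lemma norm_taylor_le_of_norm_deriv_deriv_le {M : ℝ} (hM0 : 0 ≤ M) (hg : ContDiff ℝ 2 g)
    (hM : ∀ s, ‖deriv (deriv g) s‖ ≤ M) (s t : ℝ) :
    ‖g t - g s - (t - s) • deriv g s‖ ≤ M * |t - s| ^ 2 := by
  have hd (u : ℝ) : HasDerivAt (fun u => g u - u • deriv g s) (deriv g u - deriv g s) u := by
    have h := ((hg.differentiable (by norm_num)) u).hasDerivAt.sub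
      ((hasDerivAt_id u).smul_const (deriv g s))
    rw [one_smul] at h
    exact h
  have h := (convex_uIcc s t).norm_image_sub_le_of_norm_hasDerivWithin_le
    (C := M * |t - s|) (fun u _ => (hd u).hasDerivWithinAt) (fun u hu => by
      refine (norm_sub_le_of_norm_deriv_deriv_le hg hM s u).trans ?_
      exact mul_le_mul_of_nonneg_left (Set.abs_sub_left_of_mem_uIcc hu) hM0) Set.left_mem_uIcc Set.right_mem_uIcc
  rw [Real.norm_eq_abs] at h
  have e : g t - t • deriv g s - (g s - s • deriv g s) = g t - g s - (t - s) • deriv g s := by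
    rw [sub_smul]; abel
  rw [e] at h
  linarith

lemma exists_chord_lower_bound (hL : 0 < L) (hg : ContDiff ℝ 2 g) (hper : Function.Periodic g L)
    (harc : ∀ s, ‖deriv g s‖ = 1) (hinj : Set.InjOn g (Set.Ico 0 L)) {M : ℝ} (hM0 : 0 < M)
    (hM : ∀ s, ‖deriv (deriv g) s‖ ≤ M) :
    ∃ c > 0, ∀ s t, |t - s| ≤ L / 2 → c * |t - s| ≤ ‖g s - g t‖ := by
  set K : Set (ℝ × ℝ) := Set.Icc 0 L ×ˢ {h | 1 / (2 * M) ≤ |h| ∧ |h| ≤ L / 2} with hK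
  have hKc : IsCompact K := by
    refine isCompact_Icc.prod ?_
    refine (isCompact_Icc (a := -(L / 2)) (b := L / 2)).of_isClosed_subset ?_ ?_
    · exact (isClosed_le continuous_const continuous_abs).inter
        (isClosed_le continuous_abs continuous_const)
    · rintro h ⟨-, h2⟩
      exact abs_le.1 h2
  have hcont : Continuous fun z : ℝ × ℝ => ‖g z.1 - g (z.1 + z.2)‖ := by
    have := hg.continuous
    fun_prop
  have hpos : ∀ z ∈ K, 0 < ‖g z.1 - g (z.1 + z.2)‖ := by
    rintro ⟨s, h⟩ ⟨-, h1, h2⟩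
    rw [norm_pos_iff, sub_ne_zero]
    intro hE
    obtain ⟨n, hn⟩ := exists_sub_eq_of_periodic hL hper hinj hE
    have hh : h = n * L := by simpa using hn
    have h0 : 0 < |h| := lt_of_lt_of_le (by positivity) h1
    rw [hh, abs_mul, abs_of_pos hL] at h0 h2
    have hn1 : 0 < |(n : ℝ)| := pos_of_mul_pos_left h0 hL.le
    have hn2 : (1 : ℝ) ≤ |(n : ℝ)| := by
      rw [← Int.cast_abs] at hn1 ⊢
      have hn3 : 0 < |n| := by exact_mod_cast hn1
      exact_mod_cast Int.add_one_le_iff.2 hn3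
    nlinarith
  obtain ⟨m, hm0, hm⟩ : ∃ m > 0, ∀ z ∈ K, m ≤ ‖g z.1 - g (z.1 + z.2)‖ := by
    rcases K.eq_empty_or_nonempty with h | h
    · exact ⟨1, one_pos, by simp [h]⟩
    · obtain ⟨z, hz, hmin⟩ := hKc.exists_isMinOn h hcont.continuousOn
      exact ⟨_, hpos z hz, fun w hw => hmin hw⟩
  refine ⟨min (1 / 2) (m / (L / 2)), by positivity, fun s t hst => ?_⟩
  rcases le_total |t - s| (1 / (2 * M)) with h | h
  · have h1 := norm_taylor_le_of_norm_deriv_deriv_le hM0.le hg hM s t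
    have h2 : ‖(t - s) • deriv g s‖ = |t - s| := by rw [norm_smul, harc, mul_one, Real.norm_eq_abs]
    have h3 := norm_sub_norm_le ((t - s) • deriv g s) (g t - g s)
    rw [norm_sub_rev ((t - s) • deriv g s), h2, norm_sub_rev (g t)] at h3
    have h4 : M * |t - s| ≤ 1 / 2 := by
      rw [le_div_iff₀ (by positivity)] at h
      linarith
    have h5 : min (1 / 2) (m / (L / 2)) * |t - s| ≤ 1 / 2 * |t - s| := by
      gcongr; exact min_le_left _ _
    nlinarith [abs_nonneg (t - s)]
  · obtain ⟨n, hn⟩ : ∃ n : ℤ, s + n * L ∈ Set.Ico 0 L := by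
      refine ⟨-toIcoDiv hL 0 s, ?_⟩
      have := toIcoMod_mem_Ico hL 0 s
      simp only [toIcoMod, zsmul_eq_mul, zero_add] at this
      simpa [sub_eq_add_neg] using this
    have h1 := hm (s + n * L, t - s) ⟨Set.Ico_subset_Icc_self hn, h, hst⟩
    have e : s + n * L + (t - s) = t + n * L := by ring
    simp only [e, hper.int_mul n _] at h1
    refine le_trans ?_ h1
    calc min (1 / 2) (m / (L / 2)) * |t - s| ≤ m / (L / 2) * (L / 2) := by
          gcongr; exact min_le_right _ _
      _ = m := by field_simp

/-- Uniform first and second order estimates along a closed curve in terms of chord length. -/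
lemma exists_chord_estimates (hL : 0 < L) (hg : ContDiff ℝ 2 g) (hper : Function.Periodic g L)
    (harc : ∀ s, ‖deriv g s‖ = 1) (hinj : Set.InjOn g (Set.Ico 0 L)) :
    ∃ C > 0, ∀ s t, ‖deriv g t - deriv g s‖ ≤ C * ‖g s - g t‖ ∧
      ∀ w, |det3 (deriv g s) (g s - g t) w| ≤ C * ‖g s - g t‖ ^ 2 * ‖w‖ := by
  have hper' : Function.Periodic (deriv g) L := fun s => by
    rw [← deriv_comp_add_const, show (fun x => g (x + L)) = g from funext hper]
  have hper'' : Function.Periodic (deriv (deriv g)) L := fun s => by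
    rw [← deriv_comp_add_const, show (fun x => deriv g (x + L)) = deriv g from funext hper']
  have hc1 : ContDiff ℝ 1 (deriv g) := (contDiff_succ_iff_deriv (n := 1)).1 hg |>.2.2
  have hc2 : Continuous (deriv (deriv g)) := hc1.continuous_deriv (by norm_num)
  obtain ⟨M, hM0, hM⟩ : ∃ M > 0, ∀ s, ‖deriv (deriv g) s‖ ≤ M := by
    obtain ⟨M, hM0, hM⟩ :=
      (hper''.compact_of_continuous hL.ne' hc2).isBounded.exists_pos_norm_le
    exact ⟨M, hM0, fun s => hM _ ⟨s, rfl⟩⟩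
  obtain ⟨c, hc0, hc⟩ := exists_chord_lower_bound hL hg hper harc hinj hM0 hM
  refine ⟨M / c + 6 * (M / c ^ 2), by positivity, fun s t => ?_⟩
  obtain ⟨n, hn⟩ := exists_abs_sub_le_half hL s t
  rw [← hper.int_mul n t, ← hper'.int_mul n t]
  set u := t + n * L
  have hd := hc s u hn
  set d := ‖g s - g u‖
  have hh : |u - s| ≤ d / c := by rw [le_div_iff₀ hc0]; linarith
  have hd0 : 0 ≤ d := norm_nonneg _
  constructor
  · calc ‖deriv g u - deriv g s‖ ≤ M * |u - s| := norm_sub_le_of_norm_deriv_deriv_le hg hM s u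
      _ ≤ M * (d / c) := by gcongr
      _ = M / c * d := by ring
      _ ≤ _ := by gcongr; exact le_add_of_nonneg_right (by positivity)
  · intro w
    have e : det3 (deriv g s) (g s - g u) w =
        -det3 (deriv g s) (g u - g s - (u - s) • deriv g s) w := by
      simp only [det3_apply, PiLp.sub_apply, PiLp.smul_apply, smul_eq_mul]; ring
    rw [e, abs_neg]
    calc _ ≤ 6 * (‖deriv g s‖ * ‖g u - g s - (u - s) • deriv g s‖ * ‖w‖) := abs_det3_le _ _ _
      _ ≤ 6 * (1 * (M * |u - s| ^ 2) * ‖w‖) := by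
        gcongr
        · exact (harc s).le
        · exact norm_taylor_le_of_norm_deriv_deriv_le hM0.le hg hM s u
      _ ≤ 6 * (1 * (M * (d / c) ^ 2) * ‖w‖) := by gcongr
      _ = 6 * (M / c ^ 2) * d ^ 2 * ‖w‖ := by ring
      _ ≤ _ := by gcongr; exact le_add_of_nonneg_left (by positivity)

end Estimates

/-! ### The primitive along a curve -/

lemma inner_eq_dot3 (u v : E3) : inner ℝ u v = dot3 u v := by
  rw [PiLp.inner_apply, Fin.sum_univ_three]
  simp [dot3, mul_comm]

lemma hasDerivAt_norm_e3 {y : ℝ → E3} {q : E3} {t : ℝ} (hy : HasDerivAt y q t) (h0 : y t ≠ 0) :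
    HasDerivAt (fun u => ‖y u‖) (dot3 (y t) q / ‖y t‖) t := by
  have hn : ‖y t‖ ≠ 0 := norm_ne_zero_iff.2 h0
  have h := hy.norm_sq.sqrt (by positivity)
  simp only [Real.sqrt_sq (norm_nonneg _)] at h
  convert h using 1
  rw [inner_eq_dot3]
  field_simp

lemma hasDerivAt_det3_right {y : ℝ → E3} {q : E3} {t : ℝ} (hy : HasDerivAt y q t) (p x : E3) :
    HasDerivAt (fun u => det3 p x (y u)) (det3 p x q) t := by
  have h (i : Fin 3) : HasDerivAt (fun u => y u i) (q i) t :=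
    (EuclideanSpace.proj (𝕜 := ℝ) i).hasFDerivAt.comp_hasDerivAt t hy
  simp only [det3_apply]
  exact (((((h 2).const_mul _).sub ((h 1).const_mul _)).const_mul _).add
    ((((h 0).const_mul _).sub ((h 2).const_mul _)).const_mul _)).add
    ((((h 1).const_mul _).sub ((h 0).const_mul _)).const_mul _)

lemma hasDerivAt_primCoeff {y : ℝ → E3} {x p q : E3} {t : ℝ} (hy : HasDerivAt y q t)
    (hx : x ≠ 0) (h0 : y t ≠ 0) (hxy : x ≠ y t) :
    HasDerivAt (fun u => primCoeff x p (y u)) (primCoeffDeriv x p (y t) q) t := by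
  have ha : ‖x‖ ≠ 0 := norm_ne_zero_iff.2 hx
  have hd : ‖x - y t‖ ≠ 0 := norm_ne_zero_iff.2 (sub_ne_zero.2 hxy)
  have hS : ‖x‖ + ‖y t‖ + ‖x - y t‖ ≠ 0 := by positivity
  have h1 := hasDerivAt_norm_e3 hy h0
  have h2 := hasDerivAt_norm_e3 (hy.sub_const x) (sub_ne_zero.2 hxy.symm)
  simp only [norm_sub_rev _ x] at h2
  have h3 := (hasDerivAt_det3_right hy p x).div ((h2.const_mul ‖x‖).mul ((h1.const_add ‖x‖).add h2))
    (mul_ne_zero (mul_ne_zero ha hd) hS)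
  refine h3.congr_deriv ?_
  unfold primCoeffDeriv
  simp only [Pi.add_apply, Pi.mul_apply]
  field_simp

lemma abs_primCoeff_le {C : ℝ} {x p y : E3} (hx : x ≠ 0) (hC : 0 ≤ C)
    (h : ∀ w, |det3 p (x - y) w| ≤ C * ‖x - y‖ ^ 2 * ‖w‖) :
    |primCoeff x p y| ≤ C / ‖x‖ * ‖x - y‖ := by
  have ha : 0 < ‖x‖ := norm_pos_iff.2 hx
  have e : det3 p x y = det3 p (x - y) y := by
    simp only [det3_apply, PiLp.sub_apply]; ring
  unfold primCoeff
  rw [abs_div, e]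
  refine div_le_of_le_mul₀ (abs_nonneg _) (by positivity) ?_
  rw [abs_of_nonneg (by positivity : 0 ≤ ‖x‖ * ‖x - y‖ * (‖x‖ + ‖y‖ + ‖x - y‖))]
  calc _ ≤ C * ‖x - y‖ ^ 2 * ‖y‖ := h y
    _ ≤ C * ‖x - y‖ ^ 2 * (‖x‖ + ‖y‖ + ‖x - y‖) := by
      gcongr
      linarith [norm_nonneg (x - y)]
    _ = _ := by field_simp

lemma abs_dot3_div_norm_le (u v : E3) : |dot3 u v / ‖u‖| ≤ 3 * ‖v‖ := by
  rw [abs_div, abs_norm]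
  refine div_le_of_le_mul₀ (norm_nonneg _) (by positivity) ?_
  linarith [abs_dot3_le u v]

lemma abs_primCoeffDeriv_le {C : ℝ} {x p y q : E3} (hx : x ≠ 0) (hC : 0 ≤ C) (hp : ‖p‖ = 1)
    (hq : ‖q‖ = 1) (hpq : ‖q - p‖ ≤ C * ‖x - y‖)
    (h : ∀ w, |det3 p (x - y) w| ≤ C * ‖x - y‖ ^ 2 * ‖w‖) :
    |primCoeffDeriv x p y q| ≤ 15 * C / ‖x‖ := by
  have ha : 0 < ‖x‖ := norm_pos_iff.2 hx
  have e : det3 p x y = det3 p (x - y) y := by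
    simp only [det3_apply, PiLp.sub_apply]; ring
  have e' : det3 p x q = det3 p x (q - p) := by
    simp only [det3_apply, PiLp.sub_apply]; ring
  have hy' := abs_dot3_div_norm_le y q
  have hd' := abs_dot3_div_norm_le (y - x) q
  unfold primCoeffDeriv
  rw [e, e']
  rw [norm_sub_rev y x] at hd'
  rw [hq] at hy' hd'
  set d := ‖x - y‖ with hd
  set S := ‖x‖ + ‖y‖ + d with hS
  have hd0 : 0 ≤ d := norm_nonneg _
  have hS0 : 0 < S := by positivity
  have hxS : ‖x‖ ≤ S := by rw [hS]; linarith [norm_nonneg y]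
  have hyS : ‖y‖ ≤ S := by rw [hS]; linarith [norm_nonneg x]
  have hdS : d ≤ S := by rw [hS]; linarith [norm_nonneg y]
  have h1 : |det3 p x (q - p) / (‖x‖ * d * S)| ≤ 6 * C / ‖x‖ := by
    rw [abs_div, abs_of_nonneg (by positivity : 0 ≤ ‖x‖ * d * S)]
    refine div_le_of_le_mul₀ (by positivity) (by positivity) ?_
    calc _ ≤ 6 * (‖p‖ * ‖x‖ * ‖q - p‖) := abs_det3_le _ _ _
      _ ≤ 6 * (1 * S * (C * d)) := by gcongr; exact hp.le
      _ = _ := by field_simp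
  have h2 : |dot3 (y - x) q / d * S + d * (dot3 y q / ‖y‖ + dot3 (y - x) q / d)| ≤ 9 * S := by
    refine (abs_add_le _ _).trans ?_
    rw [abs_mul, abs_mul, abs_of_pos hS0, abs_of_nonneg hd0]
    have h3 := abs_add_le (dot3 y q / ‖y‖) (dot3 (y - x) q / d)
    calc _ ≤ 3 * 1 * S + S * (3 * 1 + 3 * 1) := by gcongr; linarith
      _ = 9 * S := by ring
  have h3 : |det3 p (x - y) y * (dot3 (y - x) q / d * S +
      d * (dot3 y q / ‖y‖ + dot3 (y - x) q / d)) / (‖x‖ * d ^ 2 * S ^ 2)| ≤ 9 * C / ‖x‖ := by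
    rw [abs_div, abs_of_nonneg (by positivity : 0 ≤ ‖x‖ * d ^ 2 * S ^ 2), abs_mul]
    refine div_le_of_le_mul₀ (by positivity) (by positivity) ?_
    calc _ ≤ C * d ^ 2 * ‖y‖ * (9 * S) := by gcongr; exact h y
      _ ≤ C * d ^ 2 * S * (9 * S) := by gcongr
      _ = _ := by field_simp
  refine (abs_sub _ _).trans ?_
  calc _ ≤ 6 * C / ‖x‖ + 9 * C / ‖x‖ := add_le_add h1 h3
    _ = _ := by ring

lemma abs_gaussDensity_le {C : ℝ} {x p y q : E3} (hC : 0 ≤ C) (hpq : ‖q - p‖ ≤ C * ‖x - y‖)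
    (h : ∀ w, |det3 p (x - y) w| ≤ C * ‖x - y‖ ^ 2 * ‖w‖) :
    |gaussDensity x p y q| ≤ C ^ 2 := by
  have e : det3 p q (x - y) = -det3 p (x - y) (q - p) := by
    simp only [det3_apply, PiLp.sub_apply]; ring
  unfold gaussDensity
  rw [e, abs_div, abs_neg, abs_of_nonneg (by positivity : 0 ≤ ‖x - y‖ ^ 3)]
  refine div_le_of_le_mul₀ (by positivity) (by positivity) ?_
  calc _ ≤ C * ‖x - y‖ ^ 2 * ‖q - p‖ := h _
    _ ≤ C * ‖x - y‖ ^ 2 * (C * ‖x - y‖) := by gcongr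
    _ = _ := by ring

@[fun_prop]
lemma Measurable.dot3 {α : Type*} [MeasurableSpace α] {u v : α → E3} (hu : Measurable u)
    (hv : Measurable v) : Measurable fun z => dot3 (u z) (v z) := by
  have h {w : α → E3} (hw : Measurable w) (i : Fin 3) : Measurable fun z => w z i :=
    (EuclideanSpace.proj (𝕜 := ℝ) i).continuous.measurable.comp hw
  exact (((h hu 0).mul (h hv 0)).add ((h hu 1).mul (h hv 1))).add ((h hu 2).mul (h hv 2))

@[fun_prop]
lemma Measurable.det3 {α : Type*} [MeasurableSpace α] {u v w : α → E3} (hu : Measurable u)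
    (hv : Measurable v) (hw : Measurable w) : Measurable fun z => det3 (u z) (v z) (w z) := by
  have h {w : α → E3} (hw : Measurable w) (i : Fin 3) : Measurable fun z => w z i :=
    (EuclideanSpace.proj (𝕜 := ℝ) i).continuous.measurable.comp hw
  have hm {i j k : Fin 3} : Measurable fun z => u z i * (v z j * w z k - v z k * w z j) :=
    (h hu i).mul (((h hv j).mul (h hw k)).sub ((h hv k).mul (h hw j)))
  simp only [det3_apply]
  exact (hm.add hm).add hm

section Curve

variable {g : ℝ → E3} {L : ℝ}

lemma continuous_primCoeff (hg : ContDiff ℝ 2 g) (h0 : ∀ s, g s ≠ 0) {C s : ℝ} (hC : 0 ≤ C)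
    (h : ∀ t w, |det3 (deriv g s) (g s - g t) w| ≤ C * ‖g s - g t‖ ^ 2 * ‖w‖) :
    Continuous fun t => primCoeff (g s) (deriv g s) (g t) := by
  refine continuous_iff_continuousAt.2 fun t => ?_
  by_cases hst : g s = g t
  · have hz : primCoeff (g s) (deriv g s) (g t) = 0 := by simp [primCoeff, hst]
    rw [ContinuousAt, hz]
    refine squeeze_zero_norm (fun u => abs_primCoeff_le (h0 s) hC (h u)) ?_
    have hc : Continuous fun u => C / ‖g s‖ * ‖g s - g u‖ := by
      have := hg.continuous
      fun_prop
    simpa [hst] using hc.tendsto t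
  · exact (hasDerivAt_primCoeff (hg.differentiable (by norm_num) t).hasDerivAt
      (h0 s) (h0 t) hst).continuousAt

lemma integral_primCoeffDeriv_eq_zero (hL : 0 < L) (hg : ContDiff ℝ 2 g)
    (hper : Function.Periodic g L) (hinj : Set.InjOn g (Set.Ico 0 L)) (h0 : ∀ s, g s ≠ 0)
    {C s : ℝ} (hC : 0 ≤ C)
    (h : ∀ t w, |det3 (deriv g s) (g s - g t) w| ≤ C * ‖g s - g t‖ ^ 2 * ‖w‖)
    (hint : IntervalIntegrable (fun t => primCoeffDeriv (g s) (deriv g s) (g t) (deriv g t))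
      MeasureTheory.volume 0 L) :
    ∫ t in (0 : ℝ)..L, primCoeffDeriv (g s) (deriv g s) (g t) (deriv g t) = 0 := by
  have hcount : (Set.range fun n : ℤ => s + n * L).Countable := Set.countable_range _
  rw [MeasureTheory.integral_eq_of_hasDerivAt_off_countable_of_le
    (fun t => primCoeff (g s) (deriv g s) (g t)) _ hL.le hcount
    (continuous_primCoeff hg h0 hC h).continuousOn (fun t ht => ?_) hint]
  · have e : g L = g 0 := by simpa using hper 0
    simp [e]
  · refine hasDerivAt_primCoeff (hg.differentiable (by norm_num) t).hasDerivAt (h0 s) (h0 t) ?_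
    intro hst
    obtain ⟨n, hn⟩ := exists_sub_eq_of_periodic hL hper hinj hst
    exact ht.2 ⟨n, hn.symm⟩

end Curve

lemma intervalIntegral_intervalIntegral_eq_integral_prod {F : ℝ × ℝ → ℝ} {a b : ℝ} (hab : a ≤ b)
    (hF : MeasureTheory.Integrable F ((MeasureTheory.volume.restrict (Set.Ioc a b)).prod
      (MeasureTheory.volume.restrict (Set.Ioc a b)))) :
    ∫ s in a..b, ∫ t in a..b, F (s, t) =
      ∫ z, F z ∂((MeasureTheory.volume.restrict (Set.Ioc a b)).prod
        (MeasureTheory.volume.restrict (Set.Ioc a b))) := by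
  simp only [intervalIntegral.integral_of_le hab]
  rw [MeasureTheory.integral_prod _ hF]

lemma hasDerivAt_inv3_comp {f : ℝ → E3} {v P : E3} {t : ℝ} (r : ℝ) (hf : HasDerivAt f v t)
    (h0 : f t ≠ P) : HasDerivAt (fun u => inv3 P r (f u)) (dInv P r (f t) v) t := by
  have ha : ‖f t - P‖ ≠ 0 := norm_ne_zero_iff.2 (sub_ne_zero.2 h0)
  have hg := hf.sub_const P
  have hn := hg.norm_sq
  rw [inner_eq_dot3] at hn
  have h := (((hasDerivAt_const t (r ^ 2)).div hn (by positivity)).smul hg).const_add P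
  refine h.congr_deriv ?_
  unfold dInv
  rw [smul_sub _ v, smul_smul, sub_eq_add_neg (_ • v), ← neg_smul]
  congr 2
  field_simp
  ring

/-- The integrals of `primCoeffDeriv` along a closed curve that avoids the origin cancel, so
inversion reverses the sign of the Gauss integral. -/
lemma integral_gaussDensity_inversion {g : ℝ → E3} {L : ℝ} (hL : 0 < L) (hg : ContDiff ℝ 2 g)
    (hper : Function.Periodic g L) (harc : ∀ s, ‖deriv g s‖ = 1)
    (hinj : Set.InjOn g (Set.Ico 0 L)) (h0 : ∀ s, g s ≠ 0) {r : ℝ} (hr : 0 < r) :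
    ∫ s in (0 : ℝ)..L, ∫ t in (0 : ℝ)..L,
      gaussDensity ((r ^ 2 / ‖g s‖ ^ 2) • g s) (dInv 0 r (g s) (deriv g s))
        ((r ^ 2 / ‖g t‖ ^ 2) • g t) (dInv 0 r (g t) (deriv g t)) =
    - ∫ s in (0 : ℝ)..L, ∫ t in (0 : ℝ)..L,
      gaussDensity (g s) (deriv g s) (g t) (deriv g t) := by
  obtain ⟨C, hC0, hC⟩ := exists_chord_estimates hL hg hper harc hinj
  obtain ⟨m, hm0, hm⟩ : ∃ m > 0, ∀ s, m ≤ ‖g s‖ := by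
    obtain ⟨x, ⟨s, rfl⟩, hmin⟩ := (hper.compact_of_continuous hL.ne' hg.continuous).exists_isMinOn
      (Set.range_nonempty g) continuous_norm.continuousOn
    exact ⟨‖g s‖, norm_pos_iff.2 (h0 s), fun t => hmin ⟨t, rfl⟩⟩
  set B : ℝ × ℝ → ℝ := fun z => primCoeffDeriv (g z.1) (deriv g z.1) (g z.2) (deriv g z.2) with hB
  set G : ℝ × ℝ → ℝ := fun z => gaussDensity (g z.1) (deriv g z.1) (g z.2) (deriv g z.2) with hG
  have hBle (z : ℝ × ℝ) : ‖B z‖ ≤ 15 * C / m :=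
    (abs_primCoeffDeriv_le (h0 _) hC0.le (harc _) (harc _) (hC _ _).1 (hC _ _).2).trans
      (by gcongr; exact hm _)
  have hGle (z : ℝ × ℝ) : ‖G z‖ ≤ C ^ 2 := abs_gaussDensity_le hC0.le (hC _ _).1 (hC _ _).2
  have hgm : Measurable g := hg.continuous.measurable
  have hdm : Measurable (deriv g) := measurable_deriv g
  have hBm : Measurable B := by
    simp only [hB, primCoeffDeriv]
    fun_prop
  have hGm : Measurable G := by
    simp only [hG, gaussDensity]
    fun_prop
  set μ : MeasureTheory.Measure ℝ := MeasureTheory.volume.restrict (Set.Ioc 0 L) with hμ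
  have hBi : MeasureTheory.Integrable B (μ.prod μ) :=
    .of_bound hBm.aestronglyMeasurable _ (.of_forall hBle)
  have hGi : MeasureTheory.Integrable G (μ.prod μ) :=
    .of_bound hGm.aestronglyMeasurable _ (.of_forall hGle)
  have hB0 : ∫ z, B z ∂(μ.prod μ) = 0 := by
    rw [← intervalIntegral_intervalIntegral_eq_integral_prod hL.le hBi]
    have hs (s : ℝ) : ∫ t in (0 : ℝ)..L, B (s, t) = 0 := by
      refine integral_primCoeffDeriv_eq_zero hL hg hper hinj h0 hC0.le (fun t => (hC s t).2) ?_
      rw [intervalIntegrable_iff_integrableOn_Ioc_of_le hL.le]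
      exact MeasureTheory.Integrable.of_bound
        (hBm.comp measurable_prodMk_left).aestronglyMeasurable _ (.of_forall fun t => hBle (s, t))
    simp [hs]
  have hBs : ∫ z, B z.swap ∂(μ.prod μ) = 0 := by
    rw [MeasureTheory.integral_prod_swap, hB0]
  have hBsi : MeasureTheory.Integrable (fun z => B z.swap) (μ.prod μ) := hBi.swap
  have hsum : MeasureTheory.Integrable (fun z => -2 * (B z + B z.swap)) (μ.prod μ) :=
    (hBi.add hBsi).const_mul _
  have hpt (s t : ℝ) : gaussDensity ((r ^ 2 / ‖g s‖ ^ 2) • g s) (dInv 0 r (g s) (deriv g s))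
      ((r ^ 2 / ‖g t‖ ^ 2) • g t) (dInv 0 r (g t) (deriv g t)) =
      (fun z => -2 * (B z + B z.swap) - G z) (s, t) :=
    gaussDensity_inversion _ _ _ _ (h0 s) (h0 t) hr
  have hI := intervalIntegral_intervalIntegral_eq_integral_prod hL.le (hsum.sub hGi)
  have hJ := intervalIntegral_intervalIntegral_eq_integral_prod hL.le hGi
  simp only [hpt]
  refine hI.trans ?_
  refine Eq.trans ?_ (congrArg Neg.neg hJ.symm)
  rw [MeasureTheory.integral_sub' hsum hGi, MeasureTheory.integral_const_mul,
    MeasureTheory.integral_add hBi hBsi, hB0, hBs]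
  simp [hμ]

/-- Corollary. If `f` has nowhere vanishing curvature and the
inverted knot `f̃ = I_{P,r} ∘ f` also has nowhere vanishing curvature, then
`Wr(f̃) = −Wr(f)`. -/
theorem writhe_inversion_of_nonvanishing_curvature
    (f : ℝ → E3) (L : ℝ) (hL : 0 < L)
    (hf : ContDiff ℝ (⊤ : ℕ∞) f) (hper : Function.Periodic f L)
    (harc : ∀ s, ‖deriv f s‖ = 1) (hinj : Set.InjOn f (Set.Ico 0 L))
    (hκ : ∀ s, ‖deriv (deriv f) s‖ > 0)
    (P : E3) (hP : P ∉ f '' Set.Icc 0 L) (r : ℝ) (hr : 0 < r)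
    (hreg : ∀ s, cross3 (deriv (fun t => inv3 P r (f t)) s)
        (deriv (deriv (fun t => inv3 P r (f t))) s) ≠ 0) :
    writhe (fun t => inv3 P r (f t)) L = - writhe f L := by
  have hP' (s : ℝ) : f s ≠ P := by
    intro h
    have hm := toIcoMod_mem_Ico hL 0 s
    rw [zero_add] at hm
    refine hP ⟨toIcoMod hL 0 s, Set.Ico_subset_Icc_self hm, ?_⟩
    rw [toIcoMod, hper.sub_zsmul_eq, h]
  have hf2 : ContDiff ℝ 2 f := by exact_mod_cast contDiff_infty.1 hf 2
  have hd (s : ℝ) : deriv (fun t => inv3 P r (f t)) s = dInv P r (f s) (deriv f s) :=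
    (hasDerivAt_inv3_comp r (hf2.differentiable (by norm_num) s).hasDerivAt (hP' s)).deriv
  have hdg (s : ℝ) : deriv (fun t => f t - P) s = deriv f s := by rw [deriv_sub_const]
  have key := integral_gaussDensity_inversion (g := fun t => f t - P) hL
    (hf2.sub contDiff_const) (fun s => by simp only [hper s])
    (fun s => by rw [hdg, harc]) (fun s hs t ht h => hinj hs ht (sub_left_injective h))
    (fun s => sub_ne_zero.2 (hP' s)) hr
  simp only [hdg, gaussDensity, sub_sub_sub_cancel_right] at key
  unfold writhe
  simp only [hd]
  simp only [inv3, add_sub_add_left_eq_sub]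
  simp only [dInv, sub_zero] at key ⊢
  rw [key, mul_neg]
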